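/- If G is a ℤ/3-flow-critical graph other than K₂ and K₄ with n vertices, n₃ of which have degree three, then |E(G)| ≥ n + n₃ - 1, with equality if and only if G is a wheel. -/

import Mathlib

open Finset

/-- A multigraph with a fixed orientation of its edges: each edge has a
tail and a head. -/
structure MultiGraph where
  V : Type
  E : Type
  [fV : Fintype V]
  [fE : Fintype E]
  [dV : DecidableEq V]
  [dE : DecidableEq E]
  tail : E → V
  head : E → V

namespace MultiGraph

attribute [instance] fV fE dV dE

variable (G : MultiGraph)

/-- The incidence sign `[v,e]`: `1` if `e` is oriented towards `v`, `-1` if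
oriented away from `v`, `0` otherwise (so `0` on loops). -/
def sign (v : G.V) (e : G.E) : ℤ :=
  (if G.head e = v then 1 else 0) - (if G.tail e = v then 1 else 0)

/-- A flow with values in an abelian group: conservation at every vertex. -/
def IsFlow {A : Type*} [AddCommGroup A] (φ : G.E → A) : Prop :=
  ∀ v : G.V, ∑ e : G.E, G.sign v e • φ e = 0

/-- A nowhere-zero flow. -/
def IsNZFlow {A : Type*} [AddCommGroup A] (φ : G.E → A) : Prop :=
  G.IsFlow φ ∧ ∀ e : G.E, φ e ≠ 0

/-- `G` admits a nowhere-zero `A`-flow. -/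
def HasNZFlow (A : Type*) [AddCommGroup A] : Prop :=
  ∃ φ : G.E → A, G.IsNZFlow φ

/-- Two vertices are joined by an edge (in either direction). -/
def Adj (a b : G.V) : Prop :=
  ∃ e : G.E, (G.tail e = a ∧ G.head e = b) ∨ (G.tail e = b ∧ G.head e = a)

/-- `G` is connected. -/
def Connected : Prop :=
  Nonempty G.V ∧ ∀ a b : G.V, Relation.ReflTransGen G.Adj a b

/-- Contraction of a set of edges: the contracted edges are removed and
their endpoints identified. -/
noncomputable def contract (S : Set G.E) : MultiGraph := by
  classical
  exact
  { V := Quot (fun a b : G.V => ∃ e ∈ S, G.tail e = a ∧ G.head e = b)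
    E := {e : G.E // e ∉ S}
    fV := Fintype.ofSurjective (Quot.mk _) (Quot.mk_surjective)
    tail := fun e => Quot.mk _ (G.tail e.1)
    head := fun e => Quot.mk _ (G.head e.1) }

/-- `G` is `A`-flow-critical: `G` is connected, has no nowhere-zero `A`-flow,
but every single-edge contraction does. -/
noncomputable def FlowCritical (A : Type*) [AddCommGroup A] : Prop :=
  G.Connected ∧ ¬ G.HasNZFlow A ∧ ∀ e : G.E, (G.contract {e}).HasNZFlow A

/-- The degree of a vertex (loops counted twice). -/
def degree (v : G.V) : ℕ :=
  (univ.filter fun e : G.E => G.tail e = v).card +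
    (univ.filter fun e : G.E => G.head e = v).card

/-- Incidence of a vertex and an edge. -/
def Incident (v : G.V) (e : G.E) : Prop := G.tail e = v ∨ G.head e = v

/-- The vector `δ_v ∈ (ℤ/3)^{E(G)}`, `δ_v(e) = [v,e]`. -/
def deltaV (v : G.V) : G.E → ZMod 3 := fun e => (G.sign v e : ZMod 3)

/-- The vector `δ_{v,e₁,e₂}`: `[v,e₁]` on `e₁`, `-[v,e₂]` on `e₂`, `0` elsewhere. -/
def deltaPair (v : G.V) (e₁ e₂ : G.E) : G.E → ZMod 3 := fun e =>
  if e = e₁ then (G.sign v e₁ : ZMod 3)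
  else if e = e₂ then -(G.sign v e₂ : ZMod 3) else 0

/-- The dot product on `(ℤ/3)^{E(G)}`. -/
def dot (c φ : G.E → ZMod 3) : ZMod 3 := ∑ e : G.E, c e * φ e

/-- The subspace `Δ_v`: the span of `δ_v` if `deg v ≠ 3`, and the span of `δ_v`
together with the vectors `δ_{v,e₁,e₂}` for incident edges if `deg v = 3`. -/
def DeltaSub (v : G.V) : Submodule (ZMod 3) (G.E → ZMod 3) :=
  if G.degree v = 3 then
    Submodule.span (ZMod 3) ({G.deltaV v} ∪
      {x | ∃ e₁ e₂ : G.E, e₁ ≠ e₂ ∧ G.Incident v e₁ ∧ G.Incident v e₂ ∧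
        x = G.deltaPair v e₁ e₂})
  else Submodule.span (ZMod 3) {G.deltaV v}

/-- Isomorphism of multigraphs (edges may be reversed, since the orientation
is an arbitrary fixed choice). -/
def Iso (G H : MultiGraph) : Prop :=
  ∃ (f : G.V ≃ H.V) (g : G.E ≃ H.E), ∀ e : G.E,
    (H.tail (g e) = f (G.tail e) ∧ H.head (g e) = f (G.head e)) ∨
    (H.tail (g e) = f (G.head e) ∧ H.head (g e) = f (G.tail e))

/-- The graph with two vertices joined by `m` parallel edges. -/
def banana (m : ℕ) : MultiGraph where
  V := Bool
  E := Fin m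
  tail := fun _ => false
  head := fun _ => true

/-- The wheel `W_k`: a cycle on `k` vertices plus a hub (`none`) adjacent to all
of them.  `Sum.inl` are the cycle edges, `Sum.inr` the spokes. -/
def wheel (k : ℕ) : MultiGraph where
  V := Option (Fin k)
  E := Fin k ⊕ Fin k
  tail := fun e => Sum.elim (fun i => some i) (fun i => some i) e
  head := fun e => Sum.elim (fun i => some (finRotate k i)) (fun _ => none) e

/-- `K₂`. -/
def K2 : MultiGraph := banana 1

/-- `K₄` (the wheel on `3 + 1` vertices). -/
def K4 : MultiGraph := wheel 3

/-- `G` is a wheel. -/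
def IsWheel : Prop := ∃ k : ℕ, 3 ≤ k ∧ Iso G (wheel k)

end MultiGraph
/-! ### Cycles without chords -/

/-- A finite symmetric irreflexive relation in which no walk gets stuck has a chordless cycle,
here written as a periodic sequence. -/
theorem exists_chordless_cycle {V : Type*} [Finite V] {R : V → V → Prop}
    (hsymm : ∀ a b, R a b → R b a) (hirr : ∀ a, ¬ R a a)
    (hstep : ∀ a b, R a b → ∃ c, c ≠ a ∧ R b c) {a₀ b₀ : V} (h₀ : R a₀ b₀) :
    ∃ k, 3 ≤ k ∧ ∃ c : ℕ → V, (∀ i j, c i = c j ↔ i ≡ j [MOD k]) ∧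
      (∀ i, R (c i) (c (i + 1))) ∧
      ∀ i j, R (c i) (c j) → c j = c (i + 1) ∨ c i = c (j + 1) := by
  classical
  let P : ℕ → Prop := fun k => 3 ≤ k ∧ ∃ c : ℕ → V, (∀ i j, c i = c j ↔ i ≡ j [MOD k]) ∧
      (∀ i, R (c i) (c (i + 1)))
  have close_up : ∀ (w : ℕ → V) (k : ℕ), 2 ≤ k → (∀ i j, i ≤ k → j ≤ k → w i = w j → i = j) →
      (∀ i < k, R (w i) (w (i + 1))) → R (w k) (w 0) → P (k + 1) := by
    intro w k hk hinj hadj hlast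
    refine ⟨by omega, fun n => w (n % (k + 1)), fun i j => ⟨fun h => ?_, fun h => ?_⟩, fun i => ?_⟩
    · exact hinj _ _ (Nat.le_of_lt_succ (Nat.mod_lt _ (by omega)))
        (Nat.le_of_lt_succ (Nat.mod_lt _ (by omega))) h
    · exact congrArg w h
    · have hlt := Nat.mod_lt i (show 0 < k + 1 by omega)
      by_cases hi : i % (k + 1) = k
      · have : (i + 1) % (k + 1) = 0 := by rw [Nat.add_mod, hi]; simp
        simpa only [hi, this] using hlast
      · have : (i + 1) % (k + 1) = i % (k + 1) + 1 := by
          rw [Nat.add_mod, Nat.mod_eq_of_lt (show 1 < k + 1 by omega), Nat.mod_eq_of_lt (by omega)]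
        simpa only [this] using hadj _ (by omega)
  have hP : ∃ k, P k := by
    choose! nx hnx₁ hnx₂ using hstep
    let w : ℕ → V × V := fun n => (fun p : V × V => (p.2, nx p.1 p.2))^[n] (a₀, b₀)
    have hw : ∀ n, w (n + 1) = ((w n).2, nx (w n).1 (w n).2) := fun n =>
      Function.iterate_succ_apply' _ _ _
    have hR : ∀ n, R (w n).1 (w n).2 := by
      intro n
      induction n with
      | zero => exact h₀
      | succ n ih => rw [hw]; exact hnx₂ _ _ ih
    have hadj : ∀ n, R (w n).1 (w (n + 1)).1 := fun n => by rw [hw]; exact hR n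
    have hback : ∀ n, (w (n + 2)).1 ≠ (w n).1 := fun n => by
      rw [hw (n + 1), hw n]; exact hnx₁ _ _ (hR n)
    have hrep : ∃ d, 0 < d ∧ ∃ i, (w (i + d)).1 = (w i).1 := by
      obtain ⟨i, j, hij, h⟩ := Finite.exists_ne_map_eq_of_infinite fun n => (w n).1
      rcases lt_or_gt_of_ne hij with hlt | hlt
      · exact ⟨j - i, by omega, i, by rw [Nat.add_sub_cancel' hlt.le]; exact h.symm⟩
      · exact ⟨i - j, by omega, j, by rw [Nat.add_sub_cancel' hlt.le]; exact h⟩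
    obtain ⟨hd, i, hi⟩ := Nat.find_spec hrep
    have hmin : ∀ d, 0 < d → d < Nat.find hrep → ∀ i, (w (i + d)).1 ≠ (w i).1 :=
      fun d h0 hlt i h => Nat.find_min hrep hlt ⟨h0, i, h⟩
    generalize Nat.find hrep = d at *
    have hd1 : d ≠ 1 := by
      rintro rfl
      have := hadj i
      rw [hi] at this
      exact hirr _ this
    have hd2 : d ≠ 2 := by rintro rfl; exact hback i hi
    refine ⟨d - 1 + 1, close_up (fun n => (w (i + n)).1) (d - 1) (by omega) ?_
      (fun n _ => hadj _) ?_⟩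
    · intro a b ha hb hab
      by_contra hne
      rcases lt_or_gt_of_ne hne with hlt | hlt
      · refine hmin (b - a) (by omega) (by omega) (i + a) ?_
        rw [show i + a + (b - a) = i + b by omega]; exact hab.symm
      · refine hmin (a - b) (by omega) (by omega) (i + b) ?_
        rw [show i + b + (a - b) = i + a by omega]; exact hab
    · have := hadj (i + (d - 1))
      rw [show i + (d - 1) + 1 = i + d by omega, hi] at this
      exact this
  obtain ⟨hk, c, hc, hadj⟩ := Nat.find_spec hP
  have hmin : ∀ l, P l → Nat.find hP ≤ l := fun l hl => Nat.find_min' hP hl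
  generalize Nat.find hP = k at *
  refine ⟨k, hk, c, hc, hadj, fun i j hij => ?_⟩
  obtain ⟨d, hdk, hd⟩ : ∃ d < k, c j = c (i + d) := by
    refine ⟨(j + i * (k - 1)) % k, Nat.mod_lt _ (by omega), (hc _ _).2 ?_⟩
    have h1 : i + (j + i * (k - 1)) = j + i * k := by
      obtain ⟨m, rfl⟩ : ∃ m, k = m + 1 := ⟨k - 1, by omega⟩
      simp; ring
    have h2 : i + (j + i * (k - 1)) % k ≡ i + (j + i * (k - 1)) [MOD k] :=
      (Nat.mod_modEq _ _).add_left _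
    rw [h1] at h2
    exact (h2.trans (by simp [Nat.ModEq])).symm
  by_contra hcon
  push Not at hcon
  have hd0 : d ≠ 0 := by
    rintro rfl
    rw [hd] at hij
    exact hirr _ hij
  have hd1 : d ≠ 1 := by rintro rfl; exact hcon.1 hd
  have hd2 : d ≠ k - 1 := by
    rintro rfl
    refine hcon.2 ((hc _ _).2 ?_)
    have := ((hc _ _).1 hd).add_right 1
    rw [show i + (k - 1) + 1 = i + k by omega] at this
    exact (this.trans (by simp [Nat.ModEq])).symm
  have := hmin _ (close_up (fun n => c (i + n)) d (by omega) ?_ (fun n _ => hadj _) ?_)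
  · omega
  · intro a b ha hb hab
    have := Nat.ModEq.add_left_cancel' i ((hc _ _).1 hab)
    exact Nat.ModEq.eq_of_lt_of_lt this (by omega) (by omega)
  · rw [hd] at hij
    exact hsymm _ _ hij

namespace MultiGraph

/-! ### Flows of critical graphs vanishing on a single edge -/

section Flows

variable {G : MultiGraph}

/-- The edge `e` joins `u` and `v`. -/
def Joins (G : MultiGraph) (e : G.E) (u v : G.V) : Prop :=
  (G.tail e = u ∧ G.head e = v) ∨ (G.tail e = v ∧ G.head e = u)

theorem Joins.symm {e : G.E} {u v : G.V} (h : G.Joins e u v) : G.Joins e v u := Or.symm h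

theorem Joins.incident {e : G.E} {u v : G.V} (h : G.Joins e u v) : G.Incident u e :=
  h.imp And.left And.right

theorem Joins.incident_iff {e : G.E} {u v w : G.V} (h : G.Joins e u v) :
    G.Incident w e ↔ w = u ∨ w = v := by
  rcases h with ⟨rfl, rfl⟩ | ⟨rfl, rfl⟩ <;> simp only [Incident, eq_comm]
  exact or_comm

theorem Joins.eq_of_joins {e : G.E} {u v w : G.V} (h : G.Joins e u v) (h' : G.Joins e u w) :
    v = w := by
  rcases h with ⟨rfl, rfl⟩ | ⟨rfl, rfl⟩ <;> rcases h' with ⟨h1, h2⟩ | ⟨h1, h2⟩ <;> simp_all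

theorem Incident.exists_joins {v : G.V} {e : G.E} (h : G.Incident v e) :
    ∃ w, G.Joins e v w := by
  rcases h with h | h
  · exact ⟨_, Or.inl ⟨h, rfl⟩⟩
  · exact ⟨_, Or.inr ⟨rfl, h⟩⟩

/-- The contribution of the edge `e` to the net inflow at `v`. -/
def inflow (G : MultiGraph) (φ : G.E → ZMod 3) (v : G.V) (e : G.E) : ZMod 3 :=
  (G.sign v e : ZMod 3) * φ e

theorem isFlow_iff_sum_inflow {φ : G.E → ZMod 3} :
    G.IsFlow φ ↔ ∀ v, ∑ e, G.inflow φ v e = 0 := by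
  simp only [IsFlow, inflow, zsmul_eq_mul]

theorem sum_potential_mul (φ : G.E → ZMod 3) (α : G.V → ZMod 3) :
    ∑ e, (α (G.head e) - α (G.tail e)) * φ e = ∑ v, α v * ∑ e, G.inflow φ v e := by
  simp only [mul_sum]
  rw [sum_comm]
  refine sum_congr rfl fun e _ => ?_
  simp only [inflow, sign, Int.cast_sub, Int.cast_ite, Int.cast_one, Int.cast_zero, ← mul_assoc]
  rw [← sum_mul]
  simp [mul_sub]

/-- Flows are the functions orthogonal to all potential differences. -/
theorem isFlow_iff_potential {φ : G.E → ZMod 3} :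
    G.IsFlow φ ↔ ∀ α : G.V → ZMod 3, ∑ e, (α (G.head e) - α (G.tail e)) * φ e = 0 := by
  simp only [sum_potential_mul, isFlow_iff_sum_inflow]
  refine ⟨fun h α => by simp [h], fun h v => ?_⟩
  simpa [Pi.single_apply, ite_mul] using h (Pi.single v 1)

theorem IsFlow.add_smul {φ ψ : G.E → ZMod 3} (hφ : G.IsFlow φ) (hψ : G.IsFlow ψ) (a b : ZMod 3) :
    G.IsFlow (fun e => a * φ e + b * ψ e) := by
  rw [isFlow_iff_sum_inflow] at *
  intro v
  have : ∀ e, G.inflow (fun e => a * φ e + b * ψ e) v e =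
      a * G.inflow φ v e + b * G.inflow ψ v e := fun e => by simp only [inflow]; ring
  simp only [this, sum_add_distrib, ← mul_sum, hφ, hψ, mul_zero, add_zero]

/-- A flow whose only zero is at the edge `f`. -/
def IsNearFlow (G : MultiGraph) (f : G.E) (φ : G.E → ZMod 3) : Prop :=
  G.IsFlow φ ∧ ∀ e, φ e = 0 ↔ e = f

/-- A nowhere-zero flow of `G/f` lifts to a flow of `G` which is nonzero off `f`. -/
theorem exists_lift_of_contract {f : G.E} (h : (G.contract {f}).HasNZFlow (ZMod 3)) :
    ∃ φ : G.E → ZMod 3, G.IsFlow φ ∧ ∀ e, e ≠ f → φ e ≠ 0 := by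
  classical
  obtain ⟨ψ, hψ, hnz⟩ := h
  let φ₀ : G.E → ZMod 3 := fun e => if h : e ∉ ({f} : Set G.E) then ψ ⟨e, h⟩ else 0
  have hf : φ₀ f = 0 := by simp [φ₀]
  have hφ₀ : ∀ e, e ≠ f → φ₀ e ≠ 0 := fun e he => by
    have he' : e ∉ ({f} : Set G.E) := he
    simp only [φ₀, dif_pos he']
    exact hnz ⟨e, he'⟩
  have key : ∀ α : G.V → ZMod 3, α (G.head f) = α (G.tail f) →
      ∑ e, (α (G.head e) - α (G.tail e)) * φ₀ e = 0 := by
    intro α hα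
    have hlift : ∀ a b : G.V, (∃ e ∈ ({f} : Set G.E), G.tail e = a ∧ G.head e = b) →
        α a = α b := by
      rintro a b ⟨e, he, rfl, rfl⟩
      rw [Set.mem_singleton_iff] at he
      subst he
      exact hα.symm
    have := isFlow_iff_potential.1 hψ (Quot.lift α hlift)
    rw [← this]
    refine (Finset.sum_of_injOn (Subtype.val : {e : G.E // e ∉ ({f} : Set G.E)} → G.E)
      Subtype.val_injective.injOn (fun _ _ => mem_coe.2 (@mem_univ G.E _ _)) ?_ ?_).symm
    · intro e _ he
      have : e = f := by
        by_contra hne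
        exact he ⟨⟨e, hne⟩, mem_coe.2 (@mem_univ _ (G.contract {f}).fE _), rfl⟩
      rw [this, hf, mul_zero]
    · rintro ⟨e, he⟩ _
      simp only [φ₀, dif_pos he]
      rfl
  by_cases hloop : G.head f = G.tail f
  · refine ⟨φ₀, isFlow_iff_potential.2 fun α => key α (by rw [hloop]), hφ₀⟩
  · let a : G.V → ZMod 3 := Pi.single (G.head f) 1
    let s := ∑ e, (a (G.head e) - a (G.tail e)) * φ₀ e
    have ha1 : a (G.head f) = 1 := by simp [a]
    have ha0 : a (G.tail f) = 0 := by simp [a, Ne.symm hloop]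
    refine ⟨fun e => φ₀ e + Pi.single (M := fun _ => ZMod 3) f (-s) e,
      isFlow_iff_potential.2 fun α => ?_, fun e he => by simpa [he] using hφ₀ e he⟩
    have h1 := key (fun v => α v - (α (G.head f) - α (G.tail f)) * a v)
      (by simp only [ha1, ha0]; ring)
    have h2 : ∀ e, ((α (G.head e) - (α (G.head f) - α (G.tail f)) * a (G.head e)) -
        (α (G.tail e) - (α (G.head f) - α (G.tail f)) * a (G.tail e))) * φ₀ e =
        (α (G.head e) - α (G.tail e)) * φ₀ e -
        (α (G.head f) - α (G.tail f)) * ((a (G.head e) - a (G.tail e)) * φ₀ e) :=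
      fun e => by ring
    simp only [h2, sum_sub_distrib, ← mul_sum] at h1
    simp only [mul_add, sum_add_distrib]
    rw [sum_eq_single f (f := fun e => (α (G.head e) - α (G.tail e)) *
      Pi.single (M := fun _ => ZMod 3) f (-s) e) (fun e _ he => by simp [he]) (by simp)]
    rw [Pi.single_eq_same]
    linear_combination h1

theorem FlowCritical.exists_isNearFlow (hG : G.FlowCritical (ZMod 3)) (f : G.E) :
    ∃ φ, G.IsNearFlow f φ := by
  obtain ⟨φ, hφ, hnz⟩ := exists_lift_of_contract (hG.2.2 f)
  refine ⟨φ, hφ, fun e => ⟨fun h => by_contra fun he => hnz e he h, ?_⟩⟩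
  rintro rfl
  by_contra he
  refine hG.2.1 ⟨φ, hφ, fun x => ?_⟩
  by_cases hx : x = e
  · rwa [hx]
  · exact hnz x hx

theorem FlowCritical.loopless (hG : G.FlowCritical (ZMod 3)) (e : G.E) :
    G.tail e ≠ G.head e := by
  intro he
  obtain ⟨φ, hφ, hz⟩ := hG.exists_isNearFlow e
  refine hG.2.1 ⟨fun x => if x = e then 1 else φ x, ?_, fun x => ?_⟩
  · rw [isFlow_iff_potential] at hφ ⊢
    intro α
    rw [← hφ α]
    refine sum_congr rfl fun x _ => ?_
    by_cases hx : x = e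
    · simp [hx, he]
    · simp [hx]
  · by_cases hx : x = e
    · simp [hx]
    · simpa [hx] using fun h => hx ((hz x).1 h)

theorem FlowCritical.joins_ne (hG : G.FlowCritical (ZMod 3)) {e : G.E} {u v : G.V}
    (h : G.Joins e u v) : u ≠ v := by
  rcases h with ⟨rfl, rfl⟩ | ⟨rfl, rfl⟩
  · exact hG.loopless e
  · exact (hG.loopless e).symm

theorem FlowCritical.simple (hG : G.FlowCritical (ZMod 3)) {e f : G.E} {u v : G.V}
    (he : G.Joins e u v) (hf : G.Joins f u v) : e = f := by
  by_contra hne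
  obtain ⟨φ, hφ, hz⟩ := hG.exists_isNearFlow e
  obtain ⟨σ, hσ, hσ'⟩ : ∃ σ : ZMod 3, σ * σ = 1 ∧ ∀ α : G.V → ZMod 3,
      α (G.head e) - α (G.tail e) = σ * (α (G.head f) - α (G.tail f)) := by
    rcases he with ⟨h1, h2⟩ | ⟨h1, h2⟩ <;> rcases hf with ⟨h3, h4⟩ | ⟨h3, h4⟩ <;>
      simp only [h1, h2, h3, h4]
    · exact ⟨1, by decide, fun α => by ring⟩
    · exact ⟨-1, by decide, fun α => by ring⟩
    · exact ⟨-1, by decide, fun α => by ring⟩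
    · exact ⟨1, by decide, fun α => by ring⟩
  have hf0 : φ f ≠ 0 := fun h => hne ((hz f).1 h).symm
  have he0 : φ e = 0 := (hz e).2 rfl
  refine hG.2.1 ⟨fun x => φ x + (Pi.single (M := fun _ => ZMod 3) e (-σ * φ f) x +
    Pi.single (M := fun _ => ZMod 3) f (φ f) x), ?_, fun x => ?_⟩
  · rw [isFlow_iff_potential] at hφ ⊢
    intro α
    simp only [mul_add, sum_add_distrib, hφ α]
    rw [sum_eq_single e (by intro b _ hb; simp [hb]) (by simp),
      sum_eq_single f (by intro b _ hb; simp [hb]) (by simp), Pi.single_eq_same,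
      Pi.single_eq_same, hσ']
    linear_combination (-(α (G.head f) - α (G.tail f)) * φ f) * hσ
  · by_cases hx : x = e
    · subst hx
      simp only [he0, Pi.single_eq_same, Pi.single_eq_of_ne hne]
      clear hσ'
      revert hσ hf0
      generalize φ f = y
      revert σ y
      decide
    · by_cases hx' : x = f
      · subst hx'
        simp only [Pi.single_eq_same, Pi.single_eq_of_ne hx]
        revert hf0
        generalize φ x = y
        revert y
        decide
      · simpa [hx, hx'] using fun h => hx ((hz x).1 h)

end Flows

/-! ### Flows near a vertex of degree three -/

section Local

variable {G : MultiGraph}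

theorem sign_eq_zero {v : G.V} {e : G.E} (h : ¬ G.Incident v e) : G.sign v e = 0 := by
  simp only [Incident, not_or] at h
  simp [sign, h.1, h.2]

theorem sign_mul_self {v : G.V} {e : G.E} (hl : G.tail e ≠ G.head e) (h : G.Incident v e) :
    (G.sign v e : ZMod 3) * G.sign v e = 1 := by
  rcases h with rfl | rfl
  · simp [sign, hl.symm]
  · simp [sign, hl]

theorem inflow_eq_zero_iff {v : G.V} {e : G.E} (hl : G.tail e ≠ G.head e) (h : G.Incident v e)
    {φ : G.E → ZMod 3} : G.inflow φ v e = 0 ↔ φ e = 0 := by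
  have := sign_mul_self hl h
  refine ⟨fun h0 => ?_, fun h0 => by simp [inflow, h0]⟩
  rw [inflow] at h0
  linear_combination (G.sign v e : ZMod 3) * h0 - φ e * this

theorem Joins.inflow_eq_neg {e : G.E} {u v : G.V} (h : G.Joins e u v) (φ : G.E → ZMod 3) :
    G.inflow φ v e = - G.inflow φ u e := by
  rcases h with ⟨rfl, rfl⟩ | ⟨rfl, rfl⟩ <;>
    simp only [inflow, sign, eq_comm (a := G.tail e) (b := G.head e)] <;> push_cast <;> ring

/-- The vertex `v` has exactly the three incident edges `a`, `b`, `c`. -/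
structure IsStar (G : MultiGraph) (v : G.V) (a b c : G.E) : Prop where
  hab : a ≠ b
  hac : a ≠ c
  hbc : b ≠ c
  incident_iff : ∀ x, G.Incident v x ↔ x = a ∨ x = b ∨ x = c

namespace IsStar

variable {v : G.V} {a b c : G.E}

theorem rotate (h : G.IsStar v a b c) : G.IsStar v b c a :=
  ⟨h.hbc, h.hab.symm, h.hac.symm, fun x => by rw [h.incident_iff]; tauto⟩

theorem swap (h : G.IsStar v a b c) : G.IsStar v b a c :=
  ⟨h.hab.symm, h.hbc, h.hac, fun x => by rw [h.incident_iff]; tauto⟩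

theorem incident (h : G.IsStar v a b c) : G.Incident v a := (h.incident_iff a).2 (Or.inl rfl)

theorem sum_inflow (h : G.IsStar v a b c) {φ : G.E → ZMod 3} (hφ : G.IsFlow φ) :
    G.inflow φ v a + G.inflow φ v b + G.inflow φ v c = 0 := by
  have := isFlow_iff_sum_inflow.1 hφ v
  rw [← sum_subset (subset_univ {a, b, c})] at this
  · rw [sum_insert (by simp [h.hab, h.hac]), sum_insert (by simp [h.hbc]), sum_singleton] at this
    rw [← this, add_assoc]
  · intro x _ hx
    have : ¬ G.Incident v x := by
      rw [h.incident_iff]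
      simpa using hx
    simp [inflow, sign_eq_zero this]

theorem inflow_eq_neg (h : G.IsStar v a b c) {φ : G.E → ZMod 3} (hφ : G.IsFlow φ)
    (ha : φ a = 0) : G.inflow φ v b = - G.inflow φ v c := by
  have := h.sum_inflow hφ
  rw [inflow, ha] at this
  linear_combination this

theorem inflow_eq (h : G.IsStar v a b c) (hl : ∀ e, G.tail e ≠ G.head e) {φ : G.E → ZMod 3}
    (hφ : G.IsFlow φ) (hnz : ∀ x, G.Incident v x → φ x ≠ 0) :
    G.inflow φ v a = G.inflow φ v b := by
  have h0 := h.sum_inflow hφ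
  have h1 := mt (inflow_eq_zero_iff (hl a) h.incident).1 (hnz _ h.incident)
  have h2 := mt (inflow_eq_zero_iff (hl b) h.rotate.incident).1 (hnz _ h.rotate.incident)
  have h3 := mt (inflow_eq_zero_iff (hl c) h.rotate.rotate.incident).1
    (hnz _ h.rotate.rotate.incident)
  revert h0 h1 h2 h3
  generalize G.inflow φ v a = x
  generalize G.inflow φ v b = y
  generalize G.inflow φ v c = z
  revert x y z
  decide

end IsStar

theorem degree_eq_card_incident [∀ v, DecidablePred (G.Incident v)]
    (hl : ∀ e, G.tail e ≠ G.head e) (v : G.V) :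
    G.degree v = (univ.filter (G.Incident v)).card := by
  classical
  rw [degree, ← card_union_of_disjoint, ← filter_or]
  · congr
  · rw [disjoint_filter]
    rintro e _ rfl h
    exact hl e h.symm

theorem exists_isStar (hl : ∀ e, G.tail e ≠ G.head e) {v : G.V} (hv : G.degree v = 3) :
    ∃ a b c, G.IsStar v a b c := by
  classical
  rw [degree_eq_card_incident hl, card_eq_three] at hv
  obtain ⟨a, b, c, hab, hac, hbc, h⟩ := hv
  refine ⟨a, b, c, hab, hac, hbc, fun x => ?_⟩
  have : x ∈ univ.filter (G.Incident v) ↔ x ∈ ({a, b, c} : Finset G.E) := by rw [h]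
  simpa using this

end Local

/-! ### Induced cycles of vertices of degree three -/

/-- The vertices `c i` form an induced cycle of length `k` with edges `e i`, all of whose vertices
have degree three; the third edge `s i` at `c i` leads to the vertex `h i` off the cycle. -/
structure IsRim (G : MultiGraph) (k : ℕ) (c : ℕ → G.V) (e s : ℕ → G.E) (h : ℕ → G.V) : Prop where
  three_le : 3 ≤ k
  eq_iff : ∀ i j, c i = c j ↔ i ≡ j [MOD k]
  joins : ∀ i, G.Joins (e i) (c i) (c (i + 1))
  spoke : ∀ i, G.Joins (s i) (c i) (h i)
  star : ∀ i, G.IsStar (c (i + 1)) (e (i + 1)) (e i) (s (i + 1))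
  hub_ne : ∀ i j, h i ≠ c j
  e_periodic : ∀ i, e (i + k) = e i
  s_periodic : ∀ i, s (i + k) = s i
  h_periodic : ∀ i, h (i + k) = h i

namespace IsRim

variable {G : MultiGraph} {k : ℕ} {c : ℕ → G.V} {e s : ℕ → G.E} {h : ℕ → G.V}

theorem shift (H : G.IsRim k c e s h) (m : ℕ) :
    G.IsRim k (fun i => c (i + m)) (fun i => e (i + m)) (fun i => s (i + m))
      (fun i => h (i + m)) where
  three_le := H.three_le
  eq_iff i j := (H.eq_iff _ _).trans
    ⟨fun h => Nat.ModEq.add_right_cancel' m h, fun h => h.add_right m⟩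
  joins i := by simpa only [Nat.add_right_comm i m 1] using H.joins (i + m)
  spoke i := H.spoke _
  star i := by simpa only [Nat.add_right_comm i m 1] using H.star (i + m)
  hub_ne i j := H.hub_ne _ _
  e_periodic i := by simpa only [Nat.add_right_comm i m k] using H.e_periodic (i + m)
  s_periodic i := by simpa only [Nat.add_right_comm i m k] using H.s_periodic (i + m)
  h_periodic i := by simpa only [Nat.add_right_comm i m k] using H.h_periodic (i + m)

theorem c_periodic (H : G.IsRim k c e s h) (i : ℕ) : c (i + k) = c i :=
  (H.eq_iff _ _).2 (by simp [Nat.ModEq])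

theorem c_ne (H : G.IsRim k c e s h) {i j : ℕ} (hij : i < j) (hj : j < i + k) : c i ≠ c j := by
  intro h
  have := (Nat.modEq_iff_dvd' hij.le).1 ((H.eq_iff _ _).1 h)
  exact absurd (Nat.le_of_dvd (by omega) this) (by omega)

/-- Along a stretch of the rim where a flow does not vanish, the rim vertices alternate between
sources and sinks. -/
theorem alternate (hG : G.FlowCritical (ZMod 3)) (H : G.IsRim k c e s h) {φ : G.E → ZMod 3}
    (hφ : G.IsFlow φ) {m n : ℕ}
    (hnz : ∀ i, m < i → i ≤ m + n → ∀ x, G.Incident (c i) x → φ x ≠ 0) :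
    G.inflow φ (c (m + n)) (e (m + n)) = (-1) ^ n * G.inflow φ (c m) (e m) := by
  induction n with
  | zero => simp
  | succ n ih =>
    have h1 := (H.star (m + n)).inflow_eq hG.loopless hφ (hnz _ (by omega) (by omega))
    have h2 := (H.joins (m + n)).inflow_eq_neg φ
    rw [← add_assoc, h1, h2, ih fun i h1 h2 => hnz i h1 (by omega)]
    ring

theorem ne_zero_of_spoke (H : G.IsRim k c e s h) {φ : G.E → ZMod 3}
    (hφ : G.IsNearFlow (s k) φ) {i : ℕ} (h0 : 0 < i) (hi : i < k) {x : G.E}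
    (hx : G.Incident (c i) x) : φ x ≠ 0 := by
  rw [Ne, hφ.2]
  rintro rfl
  rcases (H.spoke k).incident_iff.1 hx with h1 | h1
  · exact H.c_ne hi (by omega) h1
  · exact H.hub_ne _ _ h1.symm

theorem odd (hG : G.FlowCritical (ZMod 3)) (H : G.IsRim k c e s h) : Odd k := by
  obtain ⟨φ, hφ⟩ := hG.exists_isNearFlow (s k)
  obtain ⟨l, rfl⟩ : ∃ l, k = l + 1 := ⟨k - 1, by have := H.three_le; omega⟩
  have h1 := H.alternate hG hφ.1 (m := 0) (n := l)
    fun i h0 h1 x hx => H.ne_zero_of_spoke hφ h0 (by omega) hx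
  have h2 := (H.star l).rotate.rotate.inflow_eq_neg hφ.1 ((hφ.2 _).2 rfl)
  rw [(H.joins l).inflow_eq_neg, neg_neg] at h2
  have h3 : e (l + 1) = e 0 := by rw [← H.e_periodic 0, zero_add]
  have h4 : c (l + 1) = c 0 := by rw [← H.c_periodic 0, zero_add]
  rw [zero_add] at h1
  rw [h1, h3, h4] at h2
  by_contra hodd
  rw [Nat.odd_add_one, not_not] at hodd
  rw [hodd.neg_one_pow] at h2
  have h5 : G.inflow φ (c 0) (e 0) = 0 := by
    revert h2
    generalize G.inflow φ (c 0) (e 0) = y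
    revert y
    decide
  rw [inflow_eq_zero_iff (hG.loopless _) (H.joins 0).incident] at h5
  have hk := H.three_le
  exact H.ne_zero_of_spoke hφ (i := 1) (by omega) (by omega) (H.joins 0).symm.incident h5

/-- Every edge of the graph meets the rim. -/
theorem exists_incident (hG : G.FlowCritical (ZMod 3)) (H : G.IsRim k c e s h) (f : G.E) :
    ∃ i, 0 < i ∧ i ≤ k ∧ G.Incident (c i) f := by
  by_contra! hf
  obtain ⟨φ, hφ⟩ := hG.exists_isNearFlow f
  have hnz : ∀ i, 0 < i → i ≤ k → ∀ x, G.Incident (c i) x → φ x ≠ 0 := by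
    intro i h0 hi x hx h
    rw [hφ.2] at h
    exact hf i h0 hi (h ▸ hx)
  have h1 := H.alternate hG hφ.1 (m := 0) (n := k) fun i h0 hi => hnz i h0 (by omega)
  rw [(H.odd hG).neg_one_pow, H.e_periodic, H.c_periodic] at h1
  have hk := H.three_le
  have h2 : G.inflow φ (c 0) (e 0) ≠ 0 := by
    rw [Ne, inflow_eq_zero_iff (hG.loopless _) (H.joins 0).incident]
    exact hnz 1 (by omega) (by omega) _ (H.joins 0).symm.incident
  revert h1 h2
  generalize G.inflow φ (c 0) (e 0) = y
  revert y
  decide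

theorem incident_iff (H : G.IsRim k c e s h) {i : ℕ} (hi : 0 < i) {x : G.E} :
    G.Incident (c i) x ↔ x = e i ∨ x = e (i - 1) ∨ x = s i := by
  obtain ⟨i, rfl⟩ : ∃ j, i = j + 1 := ⟨i - 1, by omega⟩
  exact (H.star i).incident_iff x

/-- Neighbouring spokes end at the same hub. -/
theorem hub_eq_one (hG : G.FlowCritical (ZMod 3)) (H : G.IsRim k c e s h) : h 0 = h 1 := by
  obtain ⟨φ, hφ⟩ := hG.exists_isNearFlow (e 0)
  obtain ⟨ψ, hψ⟩ := hG.exists_isNearFlow (s k)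
  obtain ⟨l, rfl⟩ : ∃ l, k = l + 3 := ⟨k - 3, by have := H.three_le; omega⟩
  have hodd : Even l := by
    have := H.odd hG
    rw [Nat.odd_iff] at this
    rw [Nat.even_iff]
    omega
  have hφnz : ∀ i, 2 ≤ i → i ≤ l + 2 → ∀ x, G.Incident (c i) x → φ x ≠ 0 := by
    intro i h0 hi x hx
    rw [Ne, hφ.2]
    rintro rfl
    rcases (H.joins 0).incident_iff.1 hx with h1 | h1
    · exact H.c_ne (show 0 < i by omega) (by omega) h1.symm
    · exact H.c_ne (show 0 + 1 < i by omega) (by omega) h1.symm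
  have hψnz : ∀ i, 0 < i → i ≤ l + 2 → ∀ x, G.Incident (c i) x → ψ x ≠ 0 :=
    fun i h0 hi x hx => H.ne_zero_of_spoke hψ h0 (by omega) hx
  set t := G.inflow φ (c 1) (e 1) with ht
  set τ := G.inflow ψ (c 0) (e 0) with hτ
  have ht0 : t ≠ 0 := by
    rw [ht, Ne, inflow_eq_zero_iff (hG.loopless _) (H.joins 1).incident]
    exact hφnz 2 (by omega) (by omega) _ (H.joins 1).symm.incident
  have hτ0 : τ ≠ 0 := by
    rw [hτ, Ne, inflow_eq_zero_iff (hG.loopless _) (H.joins 0).incident]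
    exact hψnz 1 (by omega) (by omega) _ (H.joins 0).symm.incident
  have hφe : ∀ i ≤ l + 1, G.inflow φ (c (i + 1)) (e (i + 1)) = (-1) ^ i * t := fun i hi => by
    rw [add_comm i 1]
    exact H.alternate hG hφ.1 (m := 1) (n := i) fun j h1 h2 => hφnz j (by omega) (by omega)
  have hφs : ∀ i, 1 ≤ i → i ≤ l + 1 → G.inflow φ (c (i + 1)) (s (i + 1)) = (-1) ^ i * t :=
    fun i h1 hi => by
      rw [← hφe i hi]
      exact (H.star i).rotate.rotate.inflow_eq hG.loopless hφ.1 (hφnz _ (by omega) (by omega))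
  have hψs : ∀ i ≤ l + 1, G.inflow ψ (c (i + 1)) (s (i + 1)) = (-1) ^ (i + 1) * τ :=
    fun i hi => by
      have h1 := H.alternate hG hψ.1 (m := 0) (n := i + 1)
        fun j h1 h2 => hψnz j (by omega) (by omega)
      rw [zero_add] at h1
      rw [← h1]
      exact (H.star i).rotate.rotate.inflow_eq hG.loopless hψ.1 (hψnz _ (by omega) (by omega))
  have hφ1 : G.inflow φ (c 1) (s 1) = - t := by
    have := (H.star 0).swap.inflow_eq_neg hφ.1 ((hφ.2 _).2 rfl)
    rw [zero_add] at this
    rw [ht, this, neg_neg]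
  let χ : G.E → ZMod 3 := fun x => τ * φ x + t * ψ x
  have hχ : G.IsFlow χ := hφ.1.add_smul hψ.1 τ t
  have hχin : ∀ v x, G.inflow χ v x = τ * G.inflow φ v x + t * G.inflow ψ v x :=
    fun v x => by simp only [χ, inflow]; ring
  have hχ1 : G.inflow χ (c 1) (s 1) ≠ 0 := by
    have := hψs 0 (by omega)
    rw [zero_add] at this
    rw [hχin, hφ1, this]
    clear_value t τ
    clear * - ht0 hτ0
    revert t τ
    decide
  have hχ0 : ∀ i, 2 ≤ i → i ≤ l + 2 → χ (s i) = 0 := by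
    intro i h2 hi
    obtain ⟨i, rfl⟩ : ∃ j, i = j + 1 := ⟨i - 1, by omega⟩
    rw [← inflow_eq_zero_iff (hG.loopless _) (H.spoke _).incident, hχin,
      hφs i (by omega) (by omega), hψs i (by omega)]
    ring
  by_contra hne
  have hsum := isFlow_iff_sum_inflow.1 hχ (h 1)
  rw [sum_eq_single (s 1), (H.spoke 1).inflow_eq_neg, neg_eq_zero] at hsum
  · exact hχ1 hsum
  · intro x _ hx1
    by_cases hx : G.Incident (h 1) x
    · obtain ⟨i, h0, hi, hix⟩ := H.exists_incident hG x
      rw [H.incident_iff h0] at hix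
      have hrim : ∀ j, x ≠ e j := by
        rintro j rfl
        rcases (H.joins j).incident_iff.1 hx with h | h <;> exact H.hub_ne _ _ h
      obtain rfl : x = s i := by simpa [hrim] using hix
      have hh : h 1 = h i := by
        rcases (H.spoke i).incident_iff.1 hx with h | h
        · exact absurd h (H.hub_ne _ _)
        · exact h
      have hi1 : i ≠ 1 := by rintro rfl; exact hx1 rfl
      have hik : i ≠ l + 3 := by
        rintro rfl
        apply hne
        rw [hh, ← H.h_periodic 0, zero_add]
      rw [inflow, hχ0 i (by omega) (by omega), mul_zero]
    · simp [inflow, sign_eq_zero hx]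
  · simp

theorem hub_eq (hG : G.FlowCritical (ZMod 3)) (H : G.IsRim k c e s h) (i : ℕ) : h i = h 0 := by
  induction i with
  | zero => rfl
  | succ i ih =>
    rw [← ih]
    have := (H.shift i).hub_eq_one hG
    simpa only [zero_add, add_comm 1 i] using this.symm

/-- A critical graph with a rim is a wheel. -/
theorem iso_wheel (hG : G.FlowCritical (ZMod 3)) (H : G.IsRim k c e s h) : Iso G (wheel k) := by
  have hk := H.three_le
  have hinj : ∀ {i j : ℕ}, i < k → j < k → c i = c j → i = j := fun hi hj hij =>
    Nat.ModEq.eq_of_lt_of_lt ((H.eq_iff _ _).1 hij) hi hj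
  have hspoke : ∀ i, G.Joins (s i) (c i) (h 0) := fun i => H.hub_eq hG i ▸ H.spoke i
  have hee : ∀ {i j}, i < k → j < k → e i = e j → i = j := by
    intro i j hi hj hij
    have h1 := (H.joins i).incident
    have h2 := (H.joins i).symm.incident
    rw [hij, (H.joins j).incident_iff] at h1 h2
    rcases h1 with h1 | h1
    · exact hinj hi hj h1
    · rcases h2 with h2 | h2
      · have h3 := (H.eq_iff _ _).1 h1
        have h4 := (h3.add_right 1).symm.trans ((H.eq_iff _ _).1 h2)
        have := (Nat.modEq_iff_dvd' (by omega)).1 h4.symm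
        exact absurd (Nat.le_of_dvd (by omega) this) (by omega)
      · exact hinj hi hj ((H.eq_iff _ _).2
          (Nat.ModEq.add_right_cancel' 1 ((H.eq_iff _ _).1 h2)))
  have hss : ∀ {i j}, i < k → j < k → s i = s j → i = j := by
    intro i j hi hj hij
    have h1 := (hspoke i).incident
    rw [hij, (hspoke j).incident_iff] at h1
    exact hinj hi hj (h1.resolve_right (H.hub_ne _ _).symm)
  have hes : ∀ i j, e i ≠ s j := by
    intro i j hij
    have h1 := (hspoke j).symm.incident
    rw [← hij, (H.joins i).incident_iff] at h1
    rcases h1 with h1 | h1 <;> exact H.hub_ne _ _ h1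
  have hemod : ∀ i, e (i % k) = e i := fun i => Function.Periodic.map_mod_nat H.e_periodic i
  have hsmod : ∀ i, s (i % k) = s i := fun i => Function.Periodic.map_mod_nat H.s_periodic i
  have hcmod : ∀ i, c (i % k) = c i := fun i => Function.Periodic.map_mod_nat H.c_periodic i
  have hlt : ∀ i, i % k < k := fun i => Nat.mod_lt _ (by omega)
  have hcover : ∀ x : G.E, (∃ i, x = e i) ∨ ∃ i, x = s i := by
    intro x
    obtain ⟨i, h0, -, hx⟩ := H.exists_incident hG x
    rcases (H.incident_iff h0).1 hx with hx | hx | hx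
    exacts [Or.inl ⟨_, hx⟩, Or.inl ⟨_, hx⟩, Or.inr ⟨_, hx⟩]
  have hvert : ∀ v : G.V, v = h 0 ∨ ∃ i, v = c i := by
    intro v
    by_cases hv : v = h 0
    · exact Or.inl hv
    · rcases Relation.ReflTransGen.cases_head (hG.1.2 v (h 0)) with h1 | ⟨w, ⟨x, hx⟩, -⟩
      · exact absurd h1 hv
      · have hx : G.Joins x v w := hx
        rcases hcover x with ⟨i, rfl⟩ | ⟨i, rfl⟩
        · rcases (H.joins i).incident_iff.1 hx.incident with h1 | h1 <;> exact Or.inr ⟨_, h1⟩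
        · rcases (hspoke i).incident_iff.1 hx.incident with h1 | h1
          · exact Or.inr ⟨_, h1⟩
          · exact Or.inl h1
  let F : (wheel k).V → G.V := fun o => Option.elim o (h 0) fun i => c i
  let E : (wheel k).E → G.E := Sum.elim (fun i => e i) fun i => s i
  have hF : Function.Bijective F := by
    refine ⟨?_, fun v => ?_⟩
    · rintro (_ | i) (_ | j) hij
      · rfl
      · exact absurd hij (H.hub_ne _ _)
      · exact absurd hij.symm (H.hub_ne _ _)
      · exact congrArg some (Fin.ext (hinj i.2 j.2 hij))
    · rcases hvert v with rfl | ⟨i, rfl⟩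
      · exact ⟨none, rfl⟩
      · exact ⟨some ⟨i % k, hlt i⟩, hcmod i⟩
  have hE : Function.Bijective E := by
    refine ⟨?_, fun x => ?_⟩
    · rintro (i | i) (j | j) hij
      · exact congrArg Sum.inl (Fin.ext (hee i.2 j.2 hij))
      · exact absurd hij (hes _ _)
      · exact absurd hij.symm (hes _ _)
      · exact congrArg Sum.inr (Fin.ext (hss i.2 j.2 hij))
    · rcases hcover x with ⟨i, rfl⟩ | ⟨i, rfl⟩
      · exact ⟨Sum.inl ⟨i % k, hlt i⟩, hemod i⟩
      · exact ⟨Sum.inr ⟨i % k, hlt i⟩, hsmod i⟩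
  have hrot : ∀ i : Fin k, c (finRotate k i) = c (i + 1) := by
    intro i
    obtain ⟨n, rfl⟩ : ∃ n, k = n + 1 := ⟨k - 1, by omega⟩
    rw [finRotate_apply, ← hcmod (i + 1), Fin.val_add]
    simp
  refine ⟨(Equiv.ofBijective F hF).symm, (Equiv.ofBijective E hE).symm, fun x => ?_⟩
  obtain ⟨y, rfl⟩ := hE.2 x
  have hy : (Equiv.ofBijective E hE).symm (E y) = y := (Equiv.ofBijective E hE).symm_apply_apply y
  have key : G.Joins (E y) (F ((wheel k).tail y)) (F ((wheel k).head y)) := by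
    rcases y with i | i
    · have := H.joins i
      rw [← hrot] at this
      exact this
    · exact hspoke i
  rw [hy]
  simp only [Equiv.eq_symm_apply, Equiv.ofBijective_apply]
  rcases key with ⟨h1, h2⟩ | ⟨h1, h2⟩
  · exact Or.inl ⟨h1.symm, h2.symm⟩
  · exact Or.inr ⟨h2.symm, h1.symm⟩

end IsRim

/-- If no walk among the degree-three vertices gets stuck then the critical graph is a wheel. -/
theorem FlowCritical.isWheel {G : MultiGraph} (hG : G.FlowCritical (ZMod 3)) {u : G.V}
    (hu : G.degree u = 3)
    (hleave : ∀ e f u v w, G.degree u = 3 → G.Joins e u v → G.degree v ≠ 3 → G.Joins f u w →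
      G.degree w ≠ 3 → e = f) : G.IsWheel := by
  classical
  have hnext : ∀ a b, G.degree b = 3 → ∃ c, c ≠ a ∧ G.degree c = 3 ∧ ∃ e, G.Joins e b c := by
    intro a b hb
    by_contra! hcon
    obtain ⟨x, y, z, hst⟩ := exists_isStar hG.loopless hb
    obtain ⟨vx, hx⟩ := hst.incident.exists_joins
    obtain ⟨vy, hy⟩ := hst.rotate.incident.exists_joins
    obtain ⟨vz, hz⟩ := hst.rotate.rotate.incident.exists_joins
    have hor : ∀ e v, G.Joins e b v → v = a ∨ G.degree v ≠ 3 := fun e v hv => by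
      by_contra! h
      exact hcon v h.1 h.2 e hv
    have hne : ∀ {e f v w}, e ≠ f → G.Joins e b v → G.Joins f b w → v ≠ w := by
      rintro e f v w hef hv hw rfl
      exact hef (hG.simple hv hw)
    have hxy := hne hst.hab hx hy
    have hxz := hne hst.hac hx hz
    have hyz := hne hst.hbc hy hz
    rcases hor _ _ hx with rfl | hx3 <;> rcases hor _ _ hy with rfl | hy3
    · exact hxy rfl
    · rcases hor _ _ hz with rfl | hz3
      · exact hxz rfl
      · exact hst.hbc (hleave _ _ _ _ _ hb hy hy3 hz hz3)
    · rcases hor _ _ hz with rfl | hz3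
      · exact hyz rfl
      · exact hst.hac (hleave _ _ _ _ _ hb hx hx3 hz hz3)
    · exact hst.hab (hleave _ _ _ _ _ hb hx hx3 hy hy3)
  let R : G.V → G.V → Prop := fun a b => G.degree a = 3 ∧ G.degree b = 3 ∧ ∃ e, G.Joins e a b
  obtain ⟨u', -, hu', e₀, he₀⟩ := hnext u u hu
  obtain ⟨k, hk, c, hc, hR, hchord⟩ := exists_chordless_cycle (R := R)
    (fun a b h => ⟨h.2.1, h.1, h.2.2.imp fun _ h => h.symm⟩)
    (fun a ⟨_, _, e, h⟩ => hG.joins_ne h rfl)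
    (fun a b ⟨_, hb, _⟩ => by
      obtain ⟨c, hca, hc, h⟩ := hnext a b hb
      exact ⟨c, hca, hb, hc, h⟩) (a₀ := u) (b₀ := u') ⟨hu, hu', e₀, he₀⟩
  have hperiodic : ∀ i, c (i + k) = c i := fun i => (hc _ _).2 (by simp [Nat.ModEq])
  have : ∃ E : G.V → G.V → G.E, ∀ a b, R a b → G.Joins (E a b) a b := by
    have : Nonempty G.E := ⟨e₀⟩
    choose! E hE using fun a b (h : R a b) => h.2.2
    exact ⟨E, hE⟩
  obtain ⟨E, hE⟩ := this
  have hstar : ∀ v, ∃ x w, ∀ i, c (i + 1) = v → G.Joins x v w ∧ (∀ j, w ≠ c j) ∧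
      G.IsStar v (E (c (i + 1)) (c (i + 1 + 1))) (E (c i) (c (i + 1))) x := by
    intro v
    by_cases hv : ∃ i, c (i + 1) = v
    · obtain ⟨i, rfl⟩ := hv
      have h1 := hE _ _ (hR (i + 1))
      have h0 := hE _ _ (hR i)
      have hne : c (i + 1 + 1) ≠ c i := by
        intro h
        have := (Nat.modEq_iff_dvd' (by omega)).1 ((hc _ _).1 h.symm)
        exact absurd (Nat.le_of_dvd (by omega) this) (by omega)
      have hne' : E (c (i + 1)) (c (i + 1 + 1)) ≠ E (c i) (c (i + 1)) := by
        intro h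
        rw [h] at h1
        exact hne (h1.eq_of_joins h0.symm)
      obtain ⟨x, hst⟩ : ∃ x, G.IsStar (c (i + 1)) (E (c (i + 1)) (c (i + 1 + 1)))
          (E (c i) (c (i + 1))) x := by
        obtain ⟨x, y, z, hst⟩ := exists_isStar hG.loopless (hR i).2.1
        have i1 := (hst.incident_iff _).1 h1.incident
        have i0 := (hst.incident_iff _).1 h0.symm.incident
        generalize E (c (i + 1)) (c (i + 1 + 1)) = p at *
        generalize E (c i) (c (i + 1)) = q at *
        rcases i1 with rfl | rfl | rfl <;> rcases i0 with rfl | rfl | rfl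
        · exact absurd rfl hne'
        · exact ⟨_, hst⟩
        · exact ⟨_, hst.rotate.rotate.swap⟩
        · exact ⟨_, hst.swap⟩
        · exact absurd rfl hne'
        · exact ⟨_, hst.rotate⟩
        · exact ⟨_, hst.rotate.rotate⟩
        · exact ⟨_, hst.rotate.swap⟩
        · exact absurd rfl hne'
      obtain ⟨w, hw⟩ := hst.rotate.rotate.incident.exists_joins
      refine ⟨x, w, fun j hj => ⟨hw, fun m hm => ?_, ?_⟩⟩
      · subst hm
        rcases hchord _ _ ⟨(hR i).2.1, (hR m).1, x, hw⟩ with h | h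
        · rw [h] at hw
          exact hst.hac (hG.simple h1 hw)
        · have := (hc _ _).2 (Nat.ModEq.add_right_cancel' 1 ((hc _ _).1 h))
          rw [← this] at hw
          exact hst.hbc (hG.simple h0 hw.symm)
      · have h2 : c (j + 1 + 1) = c (i + 1 + 1) := (hc _ _).2 (((hc _ _).1 hj).add_right 1)
        have h3 : c j = c i := (hc _ _).2 (Nat.ModEq.add_right_cancel' 1 ((hc _ _).1 hj))
        rw [h2, h3, hj]
        exact hst
    · exact ⟨e₀, v, fun i hi => absurd ⟨i, hi⟩ hv⟩
  choose S W hSW using hstar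
  have hSW' : ∀ i, G.Joins (S (c i)) (c i) (W (c i)) ∧ ∀ j, W (c i) ≠ c j := by
    intro i
    have := hSW (c i) (i + (k - 1))
      (by rw [show i + (k - 1) + 1 = i + k by omega, hperiodic])
    exact ⟨this.1, this.2.1⟩
  refine ⟨k, hk, IsRim.iso_wheel (c := c) (e := fun i => E (c i) (c (i + 1)))
    (s := fun i => S (c i)) (h := fun i => W (c i)) hG ?_⟩
  exact
    { three_le := hk
      eq_iff := hc
      joins := fun i => hE _ _ (hR i)
      spoke := fun i => (hSW' i).1
      star := fun i => (hSW _ i rfl).2.2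
      hub_ne := fun i => (hSW' i).2
      e_periodic := fun i => by rw [hperiodic, add_right_comm, hperiodic]
      s_periodic := fun i => by rw [hperiodic]
      h_periodic := fun i => by rw [hperiodic] }

/-! ### Degrees and isomorphisms -/

theorem degree_eq_sum (G : MultiGraph) (v : G.V) :
    G.degree v = ∑ e, ((if G.tail e = v then 1 else 0) + if G.head e = v then 1 else 0) := by
  simp only [degree, card_filter, sum_add_distrib]

theorem degree_apply_of_iso {G H : MultiGraph} (f : G.V ≃ H.V) (g : G.E ≃ H.E)
    (hfg : ∀ e, (H.tail (g e) = f (G.tail e) ∧ H.head (g e) = f (G.head e)) ∨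
      (H.tail (g e) = f (G.head e) ∧ H.head (g e) = f (G.tail e))) (v : G.V) :
    H.degree (f v) = G.degree v := by
  rw [degree_eq_sum, degree_eq_sum, ← g.sum_comp]
  refine sum_congr rfl fun e _ => ?_
  rcases hfg e with ⟨h1, h2⟩ | ⟨h1, h2⟩
  · simp only [h1, h2, f.apply_eq_iff_eq]
  · simp only [h1, h2, f.apply_eq_iff_eq]
    exact add_comm _ _

/-- The hub of a wheel. -/
def wheelHub (k : ℕ) : (wheel k).V := (none : Option (Fin k))

/-- The rim vertices of a wheel. -/
def wheelRim {k : ℕ} (i : Fin k) : (wheel k).V := some i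

theorem degree_wheelHub (k : ℕ) : (wheel k).degree (wheelHub k) = k := by
  refine (degree_eq_sum _ _).trans ?_
  change ∑ e : Fin k ⊕ Fin k, ((if Sum.elim some some e = (none : Option (Fin k)) then 1 else 0) +
    if Sum.elim (fun i => some (finRotate k i)) (fun _ => none) e = (none : Option (Fin k))
      then 1 else 0) = k
  simp

theorem degree_wheelRim {k : ℕ} (i : Fin k) : (wheel k).degree (wheelRim i) = 3 := by
  refine (degree_eq_sum _ _).trans ?_
  change ∑ e : Fin k ⊕ Fin k, ((if Sum.elim some some e = some i then 1 else 0) +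
    if Sum.elim (fun i => some (finRotate k i)) (fun _ => none) e = some i then 1 else 0) = 3
  simp [Fintype.sum_sum_type, sum_add_distrib, -finRotate_apply, -sum_boole,
    ← Equiv.eq_symm_apply]

theorem card_degree_three_wheel {k : ℕ} (hk : k ≠ 3) :
    (univ.filter fun v : (wheel k).V => (wheel k).degree v = 3).card = k := by
  rw [card_filter]
  refine (Fintype.sum_option (α := Fin k) fun v => if (wheel k).degree v = 3 then 1 else 0).trans ?_
  have h0 : (if (wheel k).degree (wheelHub k) = 3 then 1 else 0) = 0 := by
    simp [degree_wheelHub, hk]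
  have h1 : ∀ i : Fin k, (if (wheel k).degree (wheelRim i) = 3 then 1 else 0) = 1 := by
    simp [degree_wheelRim]
  exact (congrArg₂ (· + ·) h0 (sum_congr rfl fun i _ => h1 i)).trans (by simp)

/-! ### The dimension count -/

section Dimension

variable {G : MultiGraph}

theorem dot_deltaPair {v : G.V} {b c : G.E} (hbc : b ≠ c) (φ : G.E → ZMod 3) :
    dot G (G.deltaPair v b c) φ = G.inflow φ v b - G.inflow φ v c := by
  have : ∀ e, G.deltaPair v b c e * φ e = (if e = b then G.inflow φ v b else 0) -
      if e = c then G.inflow φ v c else 0 := by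
    intro e
    simp only [deltaPair, inflow]
    split_ifs with h1 h2 h2
    · exact absurd (h1.symm.trans h2) hbc
    · simp [h1]
    · simp [h2]
    · simp
  simp [dot, this]

/-- At a vertex of degree three there is a functional which kills the flows not vanishing around
the vertex, but none of the flows with a single zero at the vertex. -/
theorem FlowCritical.exists_functional (hG : G.FlowCritical (ZMod 3)) {u : G.V}
    (hu : G.degree u = 3) :
    ∃ d : G.E → ZMod 3, ∀ f φ, G.IsNearFlow f φ → (dot G d φ ≠ 0 ↔ G.Incident u f) := by
  obtain ⟨a, b, c, h⟩ := exists_isStar hG.loopless hu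
  refine ⟨G.deltaPair u b c, fun f φ hφ => ?_⟩
  rw [dot_deltaPair h.hbc]
  have h0 := fun x (hx : G.Incident u x) =>
    (inflow_eq_zero_iff (hG.loopless x) hx).trans (hφ.2 x)
  by_cases hf : G.Incident u f
  · simp only [hf, iff_true]
    have ha := h0 a h.incident
    have hb := h0 b h.rotate.incident
    have hc := h0 c h.rotate.rotate.incident
    have hs := h.sum_inflow hφ.1
    rcases (h.incident_iff f).1 hf with rfl | rfl | rfl
    all_goals
      simp only [h.hab, h.hab.symm, h.hac, h.hac.symm, h.hbc, h.hbc.symm, iff_true, iff_false]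
        at ha hb hc
      revert ha hb hc hs
      generalize G.inflow φ u _ = x
      generalize G.inflow φ u _ = y
      generalize G.inflow φ u _ = z
      revert x y z
      decide
  · simp only [hf, iff_false, not_not, sub_eq_zero]
    refine h.rotate.inflow_eq hG.loopless hφ.1 fun x hx hx0 => hf ?_
    rwa [← (hφ.2 x).1 hx0]

/-- The combination of potential differences and of the vectors `d u` with coefficients `p`,
together with the potential at `r`. -/
def potentialMap (G : MultiGraph) (r : G.V) (d : {u // G.degree u = 3} → G.E → ZMod 3) :
    (G.V → ZMod 3) × ({u // G.degree u = 3} → ZMod 3) →ₗ[ZMod 3] (G.E → ZMod 3) × ZMod 3 where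
  toFun p := (fun e => p.1 (G.head e) - p.1 (G.tail e) + ∑ u, p.2 u * d u e, p.1 r)
  map_add' p q := by
    ext
    · simp only [Prod.fst_add, Prod.snd_add, Pi.add_apply, add_mul, sum_add_distrib]
      ring
    · rfl
  map_smul' a p := by
    ext
    · simp only [Prod.smul_fst, Prod.smul_snd, Pi.smul_apply, smul_eq_mul, RingHom.id_apply,
        mul_assoc, ← mul_sum]
      ring
    · rfl

theorem dot_potentialMap (r : G.V) (d : {u // G.degree u = 3} → G.E → ZMod 3)
    (p : (G.V → ZMod 3) × ({u // G.degree u = 3} → ZMod 3)) {φ : G.E → ZMod 3}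
    (hφ : G.IsFlow φ) :
    dot G (G.potentialMap r d p).1 φ = ∑ u, p.2 u * dot G (d u) φ := by
  have h := isFlow_iff_potential.1 hφ p.1
  simp only [dot, potentialMap, LinearMap.coe_mk, AddHom.coe_mk, add_mul, sum_add_distrib, h,
    zero_add, sum_mul, mul_sum, mul_assoc]
  exact sum_comm

theorem Connected.induction (hc : G.Connected) {P : G.V → Prop} {r : G.V} (hr : P r)
    (hP : ∀ e u v, G.Joins e u v → P u → P v) (v : G.V) : P v := by
  have := hc.2 r v
  induction this with
  | refl => exact hr
  | tail _ h ih => exact h.elim fun e he => hP e _ _ he ih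

variable {r : G.V} {d : {u // G.degree u = 3} → G.E → ZMod 3}

/-- Only the degree-three ends of `f` contribute to the product with a flow vanishing at `f`. -/
theorem dot_potentialMap_of_joins
    (hd : ∀ u f φ, G.IsNearFlow f φ → (dot G (d u) φ ≠ 0 ↔ G.Incident u.1 f))
    (p : (G.V → ZMod 3) × ({u // G.degree u = 3} → ZMod 3)) {f : G.E} {φ : G.E → ZMod 3}
    (hφ : G.IsNearFlow f φ) {u : {u // G.degree u = 3}} {w : G.V} (hf : G.Joins f u w)
    (hw : ∀ h : G.degree w = 3, p.2 ⟨w, h⟩ = 0) :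
    dot G (G.potentialMap r d p).1 φ = p.2 u * dot G (d u) φ := by
  rw [dot_potentialMap r d p hφ.1]
  refine sum_eq_single u (fun v _ hv => ?_) (by simp)
  by_cases hvf : G.Incident v.1 f
  · rcases hf.incident_iff.1 hvf with h | h
    · exact absurd (Subtype.ext h) hv
    · have := hw (h ▸ v.2)
      obtain ⟨v, hv'⟩ := v
      subst h
      rw [this, zero_mul]
  · rw [← hd v f φ hφ, not_not] at hvf
    rw [hvf, mul_zero]

theorem potentialMap_injective (hG : G.FlowCritical (ZMod 3)) (hr : G.degree r ≠ 3)
    (hd : ∀ u f φ, G.IsNearFlow f φ → (dot G (d u) φ ≠ 0 ↔ G.Incident u.1 f)) :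
    Function.Injective (G.potentialMap r d) := by
  rw [injective_iff_map_eq_zero]
  rintro ⟨α, β⟩ h0
  have hβ : ∀ v (hv : G.degree v = 3), β ⟨v, hv⟩ = 0 := by
    refine hG.1.induction (r := r) (fun h => absurd h hr) fun e u v he hu hv => ?_
    obtain ⟨φ, hφ⟩ := hG.exists_isNearFlow e
    have h1 := dot_potentialMap_of_joins (r := r) hd (α, β) hφ (u := ⟨v, hv⟩) he.symm hu
    rw [h0] at h1
    have h2 := (hd ⟨v, hv⟩ e φ hφ).2 he.symm.incident
    have h3 : dot G (0 : G.E → ZMod 3) φ = 0 := by simp [dot]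
    exact (mul_eq_zero.1 (h1.symm.trans h3)).resolve_right h2
  obtain rfl : β = 0 := funext fun u => hβ u.1 u.2
  have h1 : ∀ e, α (G.head e) = α (G.tail e) := fun e => by
    have := congrFun (congrArg Prod.fst h0) e
    simpa [potentialMap, sub_eq_zero] using this
  have h2 : ∀ v, α v = 0 := by
    refine hG.1.induction (r := r) (congrArg Prod.snd h0) ?_
    rintro e u v (⟨rfl, rfl⟩ | ⟨rfl, rfl⟩) h
    · rw [h1, h]
    · rw [← h1, h]
  exact Prod.ext (funext h2) rfl

theorem finrank_potentialMap_domain : Module.finrank (ZMod 3)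
    ((G.V → ZMod 3) × ({u // G.degree u = 3} → ZMod 3)) =
      Fintype.card G.V + (univ.filter fun v : G.V => G.degree v = 3).card := by
  rw [Module.finrank_prod, Module.finrank_fintype_fun_eq_card, Module.finrank_fintype_fun_eq_card,
    Fintype.card_subtype]

theorem finrank_potentialMap_codomain :
    Module.finrank (ZMod 3) ((G.E → ZMod 3) × ZMod 3) = Fintype.card G.E + 1 := by
  rw [Module.finrank_prod, Module.finrank_fintype_fun_eq_card, Module.finrank_self]

theorem Connected.iso_K2 (hc : G.Connected) {f : G.E} (hl : G.tail f ≠ G.head f)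
    (hf : ∀ e, e = f) : Iso G K2 := by
  have hV : Function.Bijective (fun b : Bool => if b then G.head f else G.tail f) := by
    refine ⟨?_, fun v => ?_⟩
    · rintro (_ | _) (_ | _) h
      · rfl
      · exact absurd h hl
      · exact absurd h hl.symm
      · rfl
    · refine hc.induction (P := fun v => ∃ b : Bool, (if b then G.head f else G.tail f) = v)
        (r := G.tail f) ⟨false, rfl⟩ (fun e u v he _ => ?_) v
      obtain rfl := hf e
      rcases he with ⟨-, rfl⟩ | ⟨rfl, -⟩
      · exact ⟨true, rfl⟩
      · exact ⟨false, rfl⟩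
  have hE : Function.Bijective (fun _ : Fin 1 => f) :=
    ⟨fun _ _ _ => Subsingleton.elim _ _, fun e => ⟨0, (hf e).symm⟩⟩
  refine ⟨(Equiv.ofBijective _ hV).symm, (Equiv.ofBijective _ hE).symm, fun e => Or.inl ?_⟩
  obtain rfl := hf e
  exact ⟨(Equiv.eq_symm_apply _).2 rfl, (Equiv.eq_symm_apply _).2 rfl⟩

theorem isWheel_of_surjective (hG : G.FlowCritical (ZMod 3)) (hK2 : ¬ Iso G K2)
    (hd : ∀ u f φ, G.IsNearFlow f φ → (dot G (d u) φ ≠ 0 ↔ G.Incident u.1 f))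
    (hs : Function.Surjective (G.potentialMap r d)) : G.IsWheel := by
  have hdot : ∀ e (φ : G.E → ZMod 3), dot G (Pi.single e 1) φ = φ e := fun e φ => by
    simp [dot, Pi.single_apply, ite_mul]
  have hE : Nonempty G.E := by
    by_contra hE
    rw [not_nonempty_iff] at hE
    exact hG.2.1 ⟨0, fun v => by simp, fun e => hE.elim e⟩
  obtain ⟨f⟩ := hE
  obtain ⟨u, hu⟩ : ∃ u, G.degree u = 3 := by
    by_contra! h
    refine hK2 (hG.1.iso_K2 (hG.loopless f) fun e => ?_)
    obtain ⟨p, hp⟩ := hs (Pi.single e 1, 0)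
    obtain ⟨φ, hφ⟩ := hG.exists_isNearFlow f
    rw [← hφ.2, ← hdot e φ]
    have h1 := dot_potentialMap r d p hφ.1
    rw [hp] at h1
    exact h1.trans (sum_eq_zero fun u _ => absurd u.2 (h _))
  refine hG.isWheel hu fun e f u v w hu he hv hf hw => ?_
  obtain ⟨p, hp⟩ := hs (Pi.single e 1, 0)
  obtain ⟨φ, hφ⟩ := hG.exists_isNearFlow e
  obtain ⟨ψ, hψ⟩ := hG.exists_isNearFlow f
  have h1 := dot_potentialMap_of_joins (r := r) hd p hφ (u := ⟨u, hu⟩) he fun h => absurd h hv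
  have h2 := dot_potentialMap_of_joins (r := r) hd p hψ (u := ⟨u, hu⟩) hf fun h => absurd h hw
  rw [hp] at h1 h2
  simp only [hdot] at h1 h2
  rw [(hφ.2 e).2 rfl, eq_comm, mul_eq_zero,
    or_iff_left ((hd ⟨u, hu⟩ e φ hφ).2 he.incident)] at h1
  rwa [h1, zero_mul, hψ.2] at h2

end Dimension

end MultiGraph

open MultiGraph in
/-- If `G ≠ K₂, K₄` is `ℤ/3`-flow-critical with `n` vertices, `n₃` of which
have degree three, then `|E(G)| ≥ n + n₃ - 1`, with equality iff `G` is a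
wheel. -/
theorem edges_ge_of_flowCritical (G : MultiGraph)
    (hG : G.FlowCritical (ZMod 3)) (hK2 : ¬ Iso G K2) (hK4 : ¬ Iso G K4) :
    Fintype.card G.E + 1 ≥
      Fintype.card G.V + (univ.filter fun v : G.V => G.degree v = 3).card ∧
    (Fintype.card G.E + 1 =
      Fintype.card G.V + (univ.filter fun v : G.V => G.degree v = 3).card ↔
      G.IsWheel) := by
  classical
  by_cases hcubic : ∀ v, G.degree v = 3
  · obtain ⟨v⟩ := hG.1.1
    obtain ⟨k, -, f, g, hfg⟩ := hG.isWheel (hcubic v) fun _ _ _ _ _ _ _ hv => absurd (hcubic _) hv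
    have := degree_apply_of_iso f g hfg (f.symm (wheelHub k))
    rw [f.apply_symm_apply, hcubic, degree_wheelHub] at this
    subst this
    exact absurd ⟨f, g, hfg⟩ hK4
  push Not at hcubic
  obtain ⟨r, hr⟩ := hcubic
  choose d hd using fun u : {u // G.degree u = 3} => hG.exists_functional u.2
  have hinj := potentialMap_injective hG hr hd
  rw [← finrank_potentialMap_domain, ← finrank_potentialMap_codomain]
  refine ⟨LinearMap.finrank_le_finrank_of_injective hinj, fun heq => ?_, ?_⟩
  · exact isWheel_of_surjective hG hK2 hd
      ((LinearMap.injective_iff_surjective_of_finrank_eq_finrank heq.symm).1 hinj)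
  · rintro ⟨k, -, f, g, hfg⟩
    have hk : k ≠ 3 := by
      rintro rfl
      exact hK4 ⟨f, g, hfg⟩
    have h3 : (univ.filter fun v : G.V => G.degree v = 3).card = k := by
      rw [← card_degree_three_wheel hk]
      refine card_equiv f fun v => ?_
      simp [degree_apply_of_iso f g hfg]
    have hV : Fintype.card G.V = k + 1 := by
      rw [Fintype.card_congr f]
      exact (Fintype.card_option (α := Fin k)).trans (by simp)
    have hE : Fintype.card G.E = k + k := by
      rw [Fintype.card_congr g]
      exact (Fintype.card_sum (α := Fin k) (β := Fin k)).trans (by simp)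
    rw [finrank_potentialMap_domain, finrank_potentialMap_codomain, h3, hV, hE]
    ring
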